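/- Every execution starting from a configuration that contains no bad nodes is completed in a finite number of steps: after finitely many execution steps a configuration is reached in which no node is enabled. -/

import Mathlib

open scoped Classical

/-- A pre-configuration: a finite node set `V` with a partial parent map
(`none` means the node has no parent) and an integer height assignment. -/
structure PreConfig (V : Type*) where
  parent : V → Option V
  height : V → ℤ

namespace PreConfig

variable {V : Type*} [Fintype V] [LinearOrder V]

/-- The children of `u` are the nodes whose parent is `u`. -/
noncomputable def children (C : PreConfig V) (u : V) : Finset V :=
  Finset.univ.filter (fun v => C.parent v = some u)

/-- A leaf is a node with no children. -/
def IsLeaf (C : PreConfig V) (u : V) : Prop := C.children u = ∅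

/-- Maximum height value among the children of `u` (junk value `0` for a leaf). -/
noncomputable def maxH (C : PreConfig V) (u : V) : ℤ :=
  if h : (C.children u).Nonempty then (C.children u).sup' h C.height else 0

/-- Minimum height value among the children of `u` (junk value `0` for a leaf). -/
noncomputable def minH (C : PreConfig V) (u : V) : ℤ :=
  if h : (C.children u).Nonempty then (C.children u).inf' h C.height else 0

/-- A child of `u` of maximum height value; ties broken by a fixed rule
(smallest ID). Junk value `u` for a leaf. -/
noncomputable def maxChild (C : PreConfig V) (u : V) : V :=
  if h : ((C.children u).filter fun v => C.height v = C.maxH u).Nonempty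
  then ((C.children u).filter fun v => C.height v = C.maxH u).min' h else u

/-- A child of `u` of minimum height value; ties broken by a fixed rule
(smallest ID). Junk value `u` for a leaf. -/
noncomputable def minChild (C : PreConfig V) (u : V) : V :=
  if h : ((C.children u).filter fun v => C.height v = C.minH u).Nonempty
  then ((C.children u).filter fun v => C.height v = C.minH u).min' h else u

/-- `stable(u)`: `h(u) = 0` if `u` is a leaf, and `h(u) = 1 + max_{w child of u} h(w)` otherwise. -/
def Stable (C : PreConfig V) (u : V) : Prop :=
  (C.IsLeaf u ∧ C.height u = 0) ∨ (¬ C.IsLeaf u ∧ C.height u = 1 + C.maxH u)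

/-- `balanced(u)`: `|h(z) − h(z')| ≤ α` for all children `z, z'` of `u`. -/
def Balanced (α : ℤ) (C : PreConfig V) (u : V) : Prop :=
  ∀ z ∈ C.children u, ∀ z' ∈ C.children u, |C.height z - C.height z'| ≤ α

/-- `u` is enabled for a height update iff `¬stable(u)`. -/
def UpdateEnabled (C : PreConfig V) (u : V) : Prop := ¬ C.Stable u

/-- `u` is enabled for a swap iff `stable(u) ∧ stable(max(u)) ∧ ¬balanced(u)`. -/
def SwapEnabled (α : ℤ) (C : PreConfig V) (u : V) : Prop :=
  C.Stable u ∧ C.Stable (C.maxChild u) ∧ ¬ Balanced α C u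

/-- `u` is enabled iff it is enabled for a height update or for a swap. -/
def Enabled (α : ℤ) (C : PreConfig V) (u : V) : Prop :=
  C.UpdateEnabled u ∨ SwapEnabled α C u

/-- The value written by a height update: `0` for a leaf, `1 + max_{w child of u} h(w)` otherwise. -/
noncomputable def newHeight (C : PreConfig V) (u : V) : ℤ :=
  if C.IsLeaf u then 0 else 1 + C.maxH u

/-- A bad node: an internal node `u` with `h(u) ≤ max_{v child of u} h(v)`,
or a leaf `u` with `h(u) < 0`. -/
def Bad (C : PreConfig V) (u : V) : Prop :=
  (¬ C.IsLeaf u ∧ C.height u ≤ C.maxH u) ∨ (C.IsLeaf u ∧ C.height u < 0)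

/-- `v` reaches `a` by iterating the parent map. -/
def Reaches (C : PreConfig V) (v a : V) : Prop :=
  Relation.ReflTransGen (fun x y => C.parent x = some y) v a

/-- The underlying graph is a rooted tree with root `r`: `r` has no parent,
every other node has a (unique) parent, and every node reaches `r` by
iterating the parent map. -/
def IsTree (C : PreConfig V) (r : V) : Prop :=
  C.parent r = none ∧ (∀ v, C.parent v = none → v = r) ∧ ∀ v, C.Reaches v r

/-- The subtree `S_u` of `u`: the set of descendants of `u` (including `u`). -/
def subtree (C : PreConfig V) (u : V) : Set V := {v | C.Reaches v u}

/-- The actual height `h*(u)` of `u`: the length of a longest directed path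
going downward from `u` (such a maximal path necessarily ends at a leaf of `S_u`). -/
noncomputable def hstar (C : PreConfig V) (u : V) : ℕ :=
  sSup {n : ℕ | ∃ f : ℕ → V, f 0 = u ∧ ∀ i < n, C.parent (f (i + 1)) = some (f i)}

/-- An execution step `C →_A C'`: a nonempty set `A` of nodes enabled in `C` is
activated simultaneously; each `u ∈ A` enabled for a height update sets its height
to `newHeight`; each `u ∈ A` enabled for a swap replaces the edges `(u, min(u))` and
`(max(u), max(max(u)))` by `(u, max(max(u)))` and `(max(u), min(u))` (all guards and
functions evaluated in `C`); everything else is unchanged. -/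
structure Step (α : ℤ) (C C' : PreConfig V) (A : Finset V) : Prop where
  nonempty : A.Nonempty
  all_enabled : ∀ u ∈ A, Enabled α C u
  height_update : ∀ u ∈ A, C.UpdateEnabled u → C'.height u = C.newHeight u
  height_keep : ∀ u, ¬ (u ∈ A ∧ C.UpdateEnabled u) → C'.height u = C.height u
  swap_out : ∀ u ∈ A, SwapEnabled α C u → C'.parent (C.minChild u) = some (C.maxChild u)
  swap_in : ∀ u ∈ A, SwapEnabled α C u → C'.parent (C.maxChild (C.maxChild u)) = some u
  parent_keep : ∀ v, (∀ u ∈ A, SwapEnabled α C u →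
      v ≠ C.minChild u ∧ v ≠ C.maxChild (C.maxChild u)) → C'.parent v = C.parent v

end PreConfig

namespace PreConfig

variable {V : Type*} [Fintype V] [LinearOrder V]

lemma mem_children {C : PreConfig V} {u v : V} : v ∈ C.children u ↔ C.parent v = some u := by
  simp [children]

lemma height_le_maxH {C : PreConfig V} {u v : V} (hv : v ∈ C.children u) :
    C.height v ≤ C.maxH u := by
  rw [maxH, dif_pos ⟨v, hv⟩]
  exact Finset.le_sup' C.height hv

lemma minH_le_height {C : PreConfig V} {u v : V} (hv : v ∈ C.children u) :
    C.minH u ≤ C.height v := by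
  rw [minH, dif_pos ⟨v, hv⟩]
  exact Finset.inf'_le C.height hv

lemma maxChild_spec {C : PreConfig V} {u : V} (hu : (C.children u).Nonempty) :
    C.maxChild u ∈ C.children u ∧ C.height (C.maxChild u) = C.maxH u := by
  have h : ((C.children u).filter fun v => C.height v = C.maxH u).Nonempty := by
    obtain ⟨v, hv, hv'⟩ := Finset.exists_mem_eq_sup' hu C.height
    exact ⟨v, Finset.mem_filter.2 ⟨hv, by rw [maxH, dif_pos hu, hv']⟩⟩
  rw [maxChild, dif_pos h]
  exact Finset.mem_filter.1 (Finset.min'_mem _ h)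

lemma minChild_spec {C : PreConfig V} {u : V} (hu : (C.children u).Nonempty) :
    C.minChild u ∈ C.children u ∧ C.height (C.minChild u) = C.minH u := by
  have h : ((C.children u).filter fun v => C.height v = C.minH u).Nonempty := by
    obtain ⟨v, hv, hv'⟩ := Finset.exists_mem_eq_inf' hu C.height
    exact ⟨v, Finset.mem_filter.2 ⟨hv, by rw [minH, dif_pos hu, hv']⟩⟩
  rw [minChild, dif_pos h]
  exact Finset.mem_filter.1 (Finset.min'_mem _ h)

lemma not_isLeaf_iff {C : PreConfig V} {u : V} : ¬ C.IsLeaf u ↔ (C.children u).Nonempty :=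
  Finset.nonempty_iff_ne_empty.symm

/-- Heights are nonnegative and strictly increase from child to parent. For a finite node set
this is equivalent to the absence of bad nodes. -/
structure HeightOrdered (C : PreConfig V) : Prop where
  nonneg : ∀ u, 0 ≤ C.height u
  lt_parent : ∀ {v u}, C.parent v = some u → C.height v < C.height u

lemma heightOrdered_of_forall_not_bad {C : PreConfig V} (hbad : ∀ u, ¬ C.Bad u) :
    C.HeightOrdered := by
  have hlt : ∀ {v u}, C.parent v = some u → C.height v < C.height u := by
    intro v u h
    have hv := mem_children.2 h
    by_contra hle
    exact hbad u (.inl ⟨not_isLeaf_iff.2 ⟨v, hv⟩, (not_lt.1 hle).trans (height_le_maxH hv)⟩)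
  refine ⟨fun u => ?_, hlt⟩
  obtain ⟨w, -, hw⟩ := Finset.exists_min_image Finset.univ C.height ⟨u, Finset.mem_univ u⟩
  refine le_trans ?_ (hw u (Finset.mem_univ u))
  by_cases hl : C.IsLeaf w
  · by_contra hneg
    exact hbad w (.inr ⟨hl, not_le.1 hneg⟩)
  · obtain ⟨v, hv⟩ := not_isLeaf_iff.1 hl
    exact absurd (hw v (Finset.mem_univ v)) (not_le.2 (hlt (mem_children.1 hv)))

lemma HeightOrdered.newHeight_lt {C : PreConfig V} (hC : C.HeightOrdered) {u : V}
    (hu : C.UpdateEnabled u) : C.newHeight u < C.height u := by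
  have h0 := hC.nonneg u
  by_cases hl : C.IsLeaf u
  · have : C.height u ≠ 0 := fun h => hu (.inl ⟨hl, h⟩)
    rw [newHeight, if_pos hl]
    omega
  · have : C.height u ≠ 1 + C.maxH u := fun h => hu (.inr ⟨hl, h⟩)
    obtain ⟨hm, hm'⟩ := maxChild_spec (not_isLeaf_iff.1 hl)
    have := hC.lt_parent (mem_children.1 hm)
    rw [newHeight, if_neg hl]
    omega

lemma HeightOrdered.newHeight_nonneg {C : PreConfig V} (hC : C.HeightOrdered) (u : V) :
    0 ≤ C.newHeight u := by
  rw [newHeight]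
  split_ifs with hl
  · rfl
  · have := hC.nonneg (C.maxChild u)
    rw [(maxChild_spec (not_isLeaf_iff.1 hl)).2] at this
    omega

/-- The nodes involved in a swap at `u`, and their heights. -/
structure SwapData (C : PreConfig V) (u : V) : Prop where
  parent_max : C.parent (C.maxChild u) = some u
  parent_min : C.parent (C.minChild u) = some u
  parent_maxmax : C.parent (C.maxChild (C.maxChild u)) = some (C.maxChild u)
  height_eq : C.height u = 1 + C.height (C.maxChild u)
  height_max : C.height (C.maxChild u) = 1 + C.height (C.maxChild (C.maxChild u))
  height_min : C.height (C.minChild u) < C.height (C.maxChild (C.maxChild u))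

lemma HeightOrdered.swapData {C : PreConfig V} (hC : C.HeightOrdered) {α : ℤ} (hα : 1 ≤ α)
    {u : V} (hu : SwapEnabled α C u) : C.SwapData u := by
  obtain ⟨hs, hsm, hb⟩ := hu
  simp only [Balanced, not_forall, not_le] at hb
  obtain ⟨z, hz, z', hz', hlt⟩ := hb
  have hne : (C.children u).Nonempty := ⟨z, hz⟩
  obtain ⟨hmax, hmax'⟩ := maxChild_spec hne
  obtain ⟨hmin, hmin'⟩ := minChild_spec hne
  have h1 := height_le_maxH hz
  have h2 := height_le_maxH hz'
  have h3 := minH_le_height hz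
  have h4 := minH_le_height hz'
  have h5 : C.height (C.minChild u) + 1 < C.height (C.maxChild u) := by
    rcases lt_abs.1 hlt with h | h <;> omega
  have h6 := hC.nonneg (C.minChild u)
  rcases hs with ⟨hl, -⟩ | ⟨-, hs⟩
  · exact absurd hl (not_isLeaf_iff.2 hne)
  rcases hsm with ⟨-, hsm⟩ | ⟨hlm, hsm⟩
  · omega
  obtain ⟨hmm, hmm'⟩ := maxChild_spec (not_isLeaf_iff.1 hlm)
  exact ⟨mem_children.1 hmax, mem_children.1 hmin, mem_children.1 hmm, by omega, by omega,
    by omega⟩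

lemma SwapData.eq_of_minChild_eq {C : PreConfig V} {u w : V} (hu : C.SwapData u)
    (hw : C.SwapData w) (h : C.minChild u = C.minChild w) : u = w := by
  have := hu.parent_min
  rw [h, hw.parent_min] at this
  exact (Option.some.inj this).symm

lemma SwapData.eq_of_maxChild_eq {C : PreConfig V} {u w : V} (hu : C.SwapData u)
    (hw : C.SwapData w) (h : C.maxChild (C.maxChild u) = C.maxChild (C.maxChild w)) : u = w := by
  have h1 := hu.parent_maxmax
  rw [h, hw.parent_maxmax] at h1
  have h2 := hu.parent_max
  rw [← Option.some.inj h1, hw.parent_max] at h2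
  exact (Option.some.inj h2).symm

lemma SwapData.maxChild_ne_minChild {C : PreConfig V} {u w : V} (hu : C.SwapData u)
    (hw : C.SwapData w) : C.maxChild (C.maxChild u) ≠ C.minChild w := by
  intro h
  have h1 := hu.parent_maxmax
  rw [h, hw.parent_min] at h1
  have h2 := Option.some.inj h1
  have h3 := hw.height_min
  have h4 := hw.height_max
  rw [← h, h2] at h3
  rw [h2] at h4
  omega

section Step

variable {α : ℤ} {C C' : PreConfig V} {A : Finset V}

lemma Step.height_lt (h : Step α C C' A) (hC : C.HeightOrdered) {u : V} (hA : u ∈ A)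
    (hu : C.UpdateEnabled u) : C'.height u < C.height u := by
  rw [h.height_update u hA hu]
  exact hC.newHeight_lt hu

lemma Step.height_le (h : Step α C C' A) (hC : C.HeightOrdered) (u : V) :
    C'.height u ≤ C.height u := by
  by_cases hu : u ∈ A ∧ C.UpdateEnabled u
  · exact (h.height_lt hC hu.1 hu.2).le
  · exact (h.height_keep u hu).le

lemma Step.heightOrdered (h : Step α C C' A) (hα : 1 ≤ α) (hC : C.HeightOrdered) :
    C'.HeightOrdered := by
  constructor
  · intro u
    by_cases hu : u ∈ A ∧ C.UpdateEnabled u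
    · rw [h.height_update u hu.1 hu.2]
      exact hC.newHeight_nonneg u
    · rw [h.height_keep u hu]
      exact hC.nonneg u
  · intro v p hv
    have hle := h.height_le hC v
    by_cases hsw : ∀ u ∈ A, SwapEnabled α C u →
      v ≠ C.minChild u ∧ v ≠ C.maxChild (C.maxChild u)
    · rw [h.parent_keep v hsw] at hv
      have hlt := hC.lt_parent hv
      by_cases hp : p ∈ A ∧ C.UpdateEnabled p
      · have hvp := mem_children.2 hv
        rw [h.height_update p hp.1 hp.2, newHeight, if_neg (not_isLeaf_iff.2 ⟨v, hvp⟩)]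
        have := height_le_maxH hvp
        omega
      · rw [h.height_keep p hp]
        omega
    · push Not at hsw
      obtain ⟨u, huA, hu, hvu⟩ := hsw
      have d := hC.swapData hα hu
      have h1 := d.height_eq
      have h2 := d.height_max
      have h3 := d.height_min
      by_cases hmin : v = C.minChild u
      · subst hmin
        obtain rfl : C.maxChild u = p :=
          Option.some.inj ((h.swap_out u huA hu).symm.trans hv)
        rw [h.height_keep _ fun hp => hp.2 hu.2.1]
        omega
      · obtain rfl := hvu hmin
        obtain rfl : u = p := Option.some.inj ((h.swap_in u huA hu).symm.trans hv)
        rw [h.height_keep _ fun hp => hp.2 hu.1]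
        omega

/-- The height of the parent, or `0` for a parentless node. -/
def parentHeight (C : PreConfig V) (v : V) : ℤ := (C.parent v).elim 0 C.height

/-- When heights do not change, the change in parent height, weighted by the height, is accounted
for by the swaps performed. -/
lemma Step.height_mul_parentHeight_sub (h : Step α C C' A) (hα : 1 ≤ α) (hC : C.HeightOrdered)
    (hh : C'.height = C.height) (hA : ∀ u ∈ A, SwapEnabled α C u) (v : V) :
    C.height v * C'.parentHeight v - C.height v * C.parentHeight v =
      ∑ u ∈ A, ((if v = C.maxChild (C.maxChild u) then C.height v else 0) -
        (if v = C.minChild u then C.height v else 0)) := by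
  have d : ∀ u ∈ A, C.SwapData u := fun u hu => hC.swapData hα (hA u hu)
  by_cases hsw : ∀ u ∈ A, SwapEnabled α C u →
      v ≠ C.minChild u ∧ v ≠ C.maxChild (C.maxChild u)
  · rw [Finset.sum_eq_zero, parentHeight, parentHeight, h.parent_keep v hsw, hh, sub_self]
    intro u hu
    obtain ⟨h1, h2⟩ := hsw u hu (hA u hu)
    simp [h1, h2]
  · push Not at hsw
    obtain ⟨u, huA, hu, hvu⟩ := hsw
    have h1 := (d u huA).height_eq
    by_cases hmin : v = C.minChild u
    · subst hmin
      rw [Finset.sum_eq_single_of_mem u huA]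
      · rw [parentHeight, parentHeight, h.swap_out u huA hu, (d u huA).parent_min, hh,
          if_neg ((d u huA).maxChild_ne_minChild (d u huA)).symm, if_pos rfl]
        simp only [Option.elim, h1]
        ring
      · intro w hw hne
        rw [if_neg ((d w hw).maxChild_ne_minChild (d u huA)).symm,
          if_neg fun he => hne ((d u huA).eq_of_minChild_eq (d w hw) he).symm, sub_zero]
    · obtain rfl := hvu hmin
      rw [Finset.sum_eq_single_of_mem u huA]
      · rw [parentHeight, parentHeight, h.swap_in u huA hu, (d u huA).parent_maxmax, hh,
          if_pos rfl, if_neg hmin]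
        simp only [Option.elim, h1]
        ring
      · intro w hw hne
        rw [if_neg ((d u huA).maxChild_ne_minChild (d w hw)),
          if_neg fun he => hne ((d u huA).eq_of_maxChild_eq (d w hw) he).symm, sub_zero]

lemma Step.sum_height_mul_parentHeight_lt (h : Step α C C' A) (hα : 1 ≤ α)
    (hC : C.HeightOrdered) (hh : C'.height = C.height) :
    ∑ v, C.height v * C.parentHeight v < ∑ v, C'.height v * C'.parentHeight v := by
  have hA : ∀ u ∈ A, SwapEnabled α C u := fun u hu =>
    (h.all_enabled u hu).resolve_left fun hup =>
      (h.height_lt hC hu hup).ne (congrFun hh u)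
  rw [hh, ← sub_pos, ← Finset.sum_sub_distrib,
    Finset.sum_congr rfl fun v _ => h.height_mul_parentHeight_sub hα hC hh hA v,
    Finset.sum_comm]
  refine Finset.sum_pos (fun u hu => ?_) h.nonempty
  have := (hC.swapData hα (hA u hu)).height_min
  simp only [Finset.sum_sub_distrib, Finset.sum_ite_eq', Finset.mem_univ, if_true]
  omega

end Step

omit [LinearOrder V] in
lemma HeightOrdered.sum_height_mul_parentHeight_le {C : PreConfig V} (hC : C.HeightOrdered) :
    ∑ v, C.height v * C.parentHeight v ≤ ∑ v, C.height v * ∑ u, C.height u := by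
  refine Finset.sum_le_sum fun v _ => mul_le_mul_of_nonneg_left ?_ (hC.nonneg v)
  rw [parentHeight]
  cases C.parent v with
  | none => exact Finset.sum_nonneg fun u _ => hC.nonneg u
  | some p => exact Finset.single_le_sum (fun u _ => hC.nonneg u) (Finset.mem_univ p)

/-- A sequence of pointwise nonincreasing, nonnegative integer functions on a finite type is
eventually constant. -/
lemma exists_eventually_const {ι : Type*} [Fintype ι] (f : ℕ → ι → ℤ) (h0 : ∀ n, 0 ≤ f n)
    (hf : Antitone f) : ∃ N, ∀ n, f (N + n) = f N := by
  let S : ℕ → ℕ := fun n => (∑ i, f n i).toNat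
  have hS : ∀ n, (S n : ℤ) = ∑ i, f n i := fun n =>
    Int.toNat_of_nonneg (Finset.sum_nonneg fun i _ => h0 n i)
  refine ⟨Function.argmin S, fun n => ?_⟩
  set N := Function.argmin S
  have hle : f (N + n) ≤ f N := hf (Nat.le_add_right N n)
  have hge : S N ≤ S (N + n) := Function.argmin_le S (N + n)
  have heq : ∑ i, f (N + n) i = ∑ i, f N i := by
    refine le_antisymm (Finset.sum_le_sum fun i _ => hle i) ?_
    rw [← hS, ← hS]
    exact_mod_cast hge
  funext i
  exact (Finset.sum_eq_sum_iff_of_le fun i _ => hle i).1 heq i (Finset.mem_univ i)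

end PreConfig

/-- Every execution starting from a configuration with no bad nodes is
completed in a finite number of steps: since each execution step must activate a
nonempty set of enabled nodes, this is equivalent to saying that there is no
infinite execution starting from a configuration with no bad nodes. -/
theorem stmt6 {V : Type*} [Fintype V] [LinearOrder V] (α : ℤ) (hα : 1 ≤ α)
    (Cs : ℕ → PreConfig V) (As : ℕ → Finset V) (r : V)
    (hT : (Cs 0).IsTree r)
    (hstep : ∀ n, PreConfig.Step α (Cs n) (Cs (n + 1)) (As n))
    (hbad : ∀ u, ¬ (Cs 0).Bad u) :
    False := by
  have hC : ∀ n, (Cs n).HeightOrdered := fun n => by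
    induction n with
    | zero => exact PreConfig.heightOrdered_of_forall_not_bad hbad
    | succ n ih => exact (hstep n).heightOrdered hα ih
  obtain ⟨N, hN⟩ := PreConfig.exists_eventually_const (fun n => (Cs n).height)
    (fun n => (hC n).nonneg) (antitone_nat_of_succ_le fun n => (hstep n).height_le (hC n))
  let Φ : ℕ → ℤ := fun n => ∑ v, (Cs (N + n)).height v * (Cs (N + n)).parentHeight v
  have hgrow : ∀ n : ℕ, Φ 0 + n ≤ Φ n := fun n => by
    induction n with
    | zero => simp
    | succ n ih =>
      have : Φ n < Φ (n + 1) := (hstep (N + n)).sum_height_mul_parentHeight_lt hα (hC _)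
        ((hN (n + 1)).trans (hN n).symm)
      push_cast
      omega
  set B : ℤ := ∑ v, (Cs N).height v * ∑ u, (Cs N).height u
  have hbound : ∀ n, Φ n ≤ B := fun n => by
    have h : Φ n ≤ _ := (hC (N + n)).sum_height_mul_parentHeight_le
    exact h.trans_eq (by simp only [B, show (Cs (N + n)).height = (Cs N).height from hN n])
  have h1 := hgrow ((B - Φ 0).toNat + 1)
  have h2 := hbound ((B - Φ 0).toNat + 1)
  push_cast at h1
  have h3 := Int.self_le_toNat (B - Φ 0)
  omega
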